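/- Let f : ℝ → (0,∞) be C¹ with ∫ f dγ = 1 and ∫ (f′)²/f dγ < ∞, let μ(dx) = f(x)φ(x)dx, and let T = F_γ^{-1} ∘ F_μ be the increasing transport map pushing μ forward onto the standard Gaussian measure γ. Then (1/2)∫_ℝ (f′)²/f dγ − Ent_γ(f) ≥ (1/2) (∫_ℝ |1−T′(x)|/max(1,T′(x)) f(x)φ(x) dx)². -/

import Mathlib

open MeasureTheory Real Filter Asymptotics
open scoped ENNReal Topology

noncomputable section

/-- `ℝⁿ` with the Euclidean structure. -/
abbrev En (n : ℕ) := EuclideanSpace ℝ (Fin n)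

/-- Density `φₙ` of the standard Gaussian measure on `ℝⁿ`. -/
def phiN (n : ℕ) (x : En n) : ℝ := (2 * π) ^ (-(n : ℝ) / 2) * Real.exp (-‖x‖ ^ 2 / 2)

/-- The standard Gaussian measure `γₙ` on `ℝⁿ`. -/
def gaussianN (n : ℕ) : Measure (En n) :=
  volume.withDensity fun x => ENNReal.ofReal (phiN n x)

/-- Density `φ` of the standard Gaussian measure on `ℝ`. -/
def phi1 (x : ℝ) : ℝ := (2 * π) ^ (-(1 : ℝ) / 2) * Real.exp (-x ^ 2 / 2)

/-- The standard Gaussian measure `γ` on `ℝ`. -/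
def gaussian1 : Measure ℝ := volume.withDensity fun x => ENNReal.ofReal (phi1 x)

/-- Entropy `Ent_μ(f) = ∫ f log f dμ - (∫ f dμ) log (∫ f dμ)`. -/
def gEnt {α : Type*} [MeasurableSpace α] (μ : Measure α) (f : α → ℝ) : ℝ :=
  (∫ x, f x * Real.log (f x) ∂μ) - (∫ x, f x ∂μ) * Real.log (∫ x, f x ∂μ)

/-- Cumulative distribution function of the measure with density `u` on `ℝ`. -/
def cdfD (u : ℝ → ℝ) (x : ℝ) : ℝ := ∫ y in Set.Iic x, u y

/-- (Generalized) inverse of the cumulative distribution function of the density `v`. -/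
def invCdfD (v : ℝ → ℝ) (t : ℝ) : ℝ := sInf {y : ℝ | t ≤ cdfD v y}

/-- The increasing map `T = F_ν⁻¹ ∘ F_μ` transporting `μ(dx) = u(x)dx` onto `ν(dx) = v(x)dx`. -/
def transportD (u v : ℝ → ℝ) (x : ℝ) : ℝ := invCdfD v (cdfD u x)

/-- The Bucur–Fragalà distance (modulo translation)
`d(u,v) = ∫ |1 - T'| / max 1 T' dμ` between one-dimensional densities. -/
def dBF (u v : ℝ → ℝ) : ℝ :=
  ∫ x, |1 - deriv (transportD u v) x| / max 1 (deriv (transportD u v) x) * u x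


lemma phi1_eq (x : ℝ) : phi1 x = ProbabilityTheory.gaussianPDFReal 0 1 x := by
  unfold phi1 ProbabilityTheory.gaussianPDFReal
  rw [Real.sqrt_eq_rpow, ← Real.rpow_neg (by positivity)]
  norm_num

lemma phi1_pos (x : ℝ) : 0 < phi1 x := by unfold phi1; positivity

lemma phi1_hasDerivAt (x : ℝ) : HasDerivAt phi1 (-x * phi1 x) x := by
  unfold phi1
  have h1 : HasDerivAt (fun x : ℝ => -x ^ 2 / 2) (-x) x := by
    have := ((hasDerivAt_pow 2 x).neg.div_const 2)
    refine this.congr_deriv ?_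
    norm_num
    ring
  exact ((h1.exp).const_mul _).congr_deriv (by ring)

lemma phi1_cont : Continuous phi1 :=
  continuous_iff_continuousAt.2 fun x => (phi1_hasDerivAt x).continuousAt

lemma phi1_int : Integrable phi1 := by
  have : phi1 = ProbabilityTheory.gaussianPDFReal 0 1 := funext phi1_eq
  rw [this]; exact ProbabilityTheory.integrable_gaussianPDFReal 0 1

lemma phi1_integral : ∫ x, phi1 x = 1 := by
  simp_rw [phi1_eq]; exact ProbabilityTheory.integral_gaussianPDFReal_eq_one 0 (by norm_num)

lemma phi1_sq_int : Integrable (fun x => (1 + x ^ 2) * phi1 x) := by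
  have h := integrable_rpow_mul_exp_neg_mul_sq (b := 1/2) (by norm_num) (s := 2) (by norm_num)
  have h2 := (h.const_mul ((2 * π) ^ (-(1 : ℝ) / 2))).add phi1_int
  refine h2.congr (Eventually.of_forall fun x => ?_)
  simp only [Pi.add_apply, phi1]
  rw [show (-x^2/2 : ℝ) = -(1/2) * x^2 by ring]
  norm_num
  ring

lemma integral_gaussian1 (g : ℝ → ℝ) : ∫ x, g x ∂gaussian1 = ∫ x, g x * phi1 x := by
  unfold gaussian1
  rw [integral_withDensity_eq_integral_toReal_smul (by have := phi1_cont.measurable; fun_prop)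
    (by simp)]
  refine integral_congr_ae (Eventually.of_forall fun x => ?_)
  simp [ENNReal.toReal_ofReal (phi1_pos x).le, mul_comm]

lemma integrable_gaussian1 (g : ℝ → ℝ) :
    Integrable g gaussian1 ↔ Integrable (fun x => g x * phi1 x) := by
  unfold gaussian1
  rw [integrable_withDensity_iff_integrable_smul' (by have := phi1_cont.measurable; fun_prop)
    (by simp)]
  refine integrable_congr (Eventually.of_forall fun x => ?_)
  simp [ENNReal.toReal_ofReal (phi1_pos x).le, mul_comm]

section cdf
variable {u : ℝ → ℝ}

lemma cdfD_hasDerivAt (hc : Continuous u) (hi : Integrable u) (x : ℝ) :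
    HasDerivAt (cdfD u) (u x) x := by
  have h : cdfD u = fun x => cdfD u 0 + ∫ y in (0:ℝ)..x, u y := by
    funext x
    have := intervalIntegral.integral_Iic_sub_Iic (f := u) (μ := volume) (a := 0) (b := x)
      hi.integrableOn hi.integrableOn
    unfold cdfD
    linarith
  rw [h]
  exact (intervalIntegral.integral_hasDerivAt_right (hc.intervalIntegrable _ _)
    hc.aestronglyMeasurable.stronglyMeasurableAtFilter hc.continuousAt).const_add _

lemma cdfD_strictMono (hc : Continuous u) (hi : Integrable u) (hp : ∀ x, 0 < u x) :
    StrictMono (cdfD u) :=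
  strictMono_of_hasDerivAt_pos (fun x => cdfD_hasDerivAt hc hi x) hp

lemma cdfD_mem (hc : Continuous u) (hi : Integrable u) (hp : ∀ x, 0 < u x)
    (h1 : ∫ x, u x = 1) (x : ℝ) : cdfD u x ∈ Set.Ioo (0:ℝ) 1 := by
  have hm := cdfD_strictMono hc hi hp
  constructor
  · refine lt_of_le_of_lt ?_ (hm (show x - 1 < x by linarith))
    exact integral_nonneg fun y => (hp y).le
  · refine lt_of_lt_of_le (hm (show x < x + 1 by linarith)) ?_
    rw [← h1]
    exact setIntegral_le_integral hi (Eventually.of_forall fun y => (hp y).le)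

lemma cdfD_atTop (hi : Integrable u) : Tendsto (cdfD u) atTop (𝓝 (∫ x, u x)) :=
  (aecover_Iic (μ := (volume : Measure ℝ)) tendsto_id).integral_tendsto_of_countably_generated hi

lemma cdfD_atBot (hi : Integrable u) : Tendsto (cdfD u) atBot (𝓝 0) := by
  have h := (aecover_Ioi (μ := (volume : Measure ℝ)) (l := atBot) (a := fun x : ℝ => x)
    tendsto_id).integral_tendsto_of_countably_generated hi
  have h2 : cdfD u = fun x => (∫ y, u y) - ∫ y in Set.Ioi x, u y := by
    funext x
    have := intervalIntegral.integral_Iic_add_Ioi (f := u) (μ := volume) (b := x)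
      hi.integrableOn hi.integrableOn
    unfold cdfD
    linarith
  rw [h2]
  simpa using h.const_sub (∫ y, u y)

end cdf

lemma invCdf_cdf (y : ℝ) : invCdfD phi1 (cdfD phi1 y) = y := by
  have hm := cdfD_strictMono phi1_cont phi1_int phi1_pos
  unfold invCdfD
  simp only [hm.le_iff_le]
  exact csInf_Ici

lemma cdf_invCdf {t : ℝ} (ht : t ∈ Set.Ioo (0:ℝ) 1) : cdfD phi1 (invCdfD phi1 t) = t := by
  have hcont : Continuous (cdfD phi1) := continuous_iff_continuousAt.2 fun x =>
    (cdfD_hasDerivAt phi1_cont phi1_int x).continuousAt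
  have hT := cdfD_atTop phi1_int
  have hB := cdfD_atBot phi1_int
  rw [phi1_integral] at hT
  obtain ⟨a, ha⟩ := (hB.eventually (gt_mem_nhds ht.1)).exists
  obtain ⟨b, hb⟩ := (hT.eventually (lt_mem_nhds ht.2)).exists
  obtain ⟨y, rfl⟩ := mem_range_of_exists_le_of_exists_ge hcont ⟨a, ha.le⟩ ⟨b, hb.le⟩
  rw [invCdf_cdf]

lemma invCdf_hasDerivAt {t : ℝ} (ht : t ∈ Set.Ioo (0:ℝ) 1) :
    HasDerivAt (invCdfD phi1) (phi1 (invCdfD phi1 t))⁻¹ t := by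
  have hm := cdfD_strictMono phi1_cont phi1_int phi1_pos
  have hn : Set.Ioo (0:ℝ) 1 ∈ 𝓝 t := isOpen_Ioo.mem_nhds ht
  have hmono : StrictMonoOn (invCdfD phi1) (Set.Ioo 0 1) := by
    intro s hs r hr hsr
    rw [← hm.lt_iff_lt, cdf_invCdf hs, cdf_invCdf hr]; exact hsr
  have himg : invCdfD phi1 '' Set.Ioo 0 1 = Set.univ := by
    refine Set.eq_univ_of_forall fun y => ⟨cdfD phi1 y, ?_, invCdf_cdf y⟩
    exact cdfD_mem phi1_cont phi1_int phi1_pos phi1_integral y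
  refine HasDerivAt.of_local_left_inverse
    (hmono.continuousAt_of_image_mem_nhds hn (by rw [himg]; exact univ_mem))
    (cdfD_hasDerivAt phi1_cont phi1_int _) (phi1_pos _).ne' ?_
  filter_upwards [hn] with s hs using cdf_invCdf hs

lemma transport_hasDerivAt {u : ℝ → ℝ} (hc : Continuous u) (hi : Integrable u)
    (hp : ∀ x, 0 < u x) (h1 : ∫ x, u x = 1) (x : ℝ) :
    HasDerivAt (transportD u phi1) (u x / phi1 (transportD u phi1 x)) x := by
  have := (invCdf_hasDerivAt (cdfD_mem hc hi hp h1 x)).comp x (cdfD_hasDerivAt hc hi x)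
  refine this.congr_deriv ?_
  unfold transportD
  rw [div_eq_inv_mul]

/-- Elementary inequality. -/
lemma elem_ineq {s : ℝ} (hs : 0 < s) :
    (1/2) * (|1 - s| / max 1 s) ^ 2 ≤ s - 1 - Real.log s := by
  have key : ∀ r : ℝ, 0 < r → r ≤ 1 → (1/2) * (1 - r)^2 ≤ r - 1 - Real.log r ∧
      (1/2) * (1 - r)^2 ≤ 1/r - 1 + Real.log r := by
    intro r hr hr1
    constructor
    · have hd : ∀ x : ℝ, 0 < x → HasDerivAt (fun x : ℝ => x - 1 - Real.log x - (1/2) * (1 - x)^2)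
          (1 - x⁻¹ + (1 - x)) x := by
        intro x hx
        have h1 := ((((hasDerivAt_id x).sub_const 1).sub (Real.hasDerivAt_log hx.ne')).sub
          ((((hasDerivAt_id x).const_sub 1).pow 2).const_mul (1/2)))
        refine h1.congr_deriv ?_
        norm_num
        ring
      have ha := antitoneOn_of_deriv_nonpos (convex_Ioc (0:ℝ) 1)
        (fun x hx => (hd x hx.1).continuousAt.continuousWithinAt)
        (fun x hx => (hd x (interior_subset hx).1).differentiableAt.differentiableWithinAt)
        (fun x hx => by
          have hx' := interior_subset hx
          rw [(hd x hx'.1).deriv]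
          have h2 : 1 - x⁻¹ + (1 - x) = - ((1 - x)^2 * x⁻¹) := by
            have := hx'.1.ne'
            field_simp
            ring
          rw [h2]
          have := inv_pos.2 hx'.1
          have : 0 ≤ (1 - x)^2 * x⁻¹ := by positivity
          linarith)
      have := ha (show r ∈ Set.Ioc (0:ℝ) 1 from ⟨hr, hr1⟩) (by simp) hr1
      norm_num at this
      linarith
    · have hd : ∀ x : ℝ, 0 < x → HasDerivAt (fun x : ℝ => x⁻¹ - 1 + Real.log x - (1/2) * (1 - x)^2)
          (-(x^2)⁻¹ + x⁻¹ + (1 - x)) x := by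
        intro x hx
        have h1 := ((((hasDerivAt_inv hx.ne').sub_const 1).add (Real.hasDerivAt_log hx.ne')).sub
          ((((hasDerivAt_id x).const_sub 1).pow 2).const_mul (1/2)))
        refine h1.congr_deriv ?_
        norm_num
        ring
      have ha := antitoneOn_of_deriv_nonpos (convex_Ioc (0:ℝ) 1)
        (fun x hx => (hd x hx.1).continuousAt.continuousWithinAt)
        (fun x hx => (hd x (interior_subset hx).1).differentiableAt.differentiableWithinAt)
        (fun x hx => by
          have hx' := interior_subset hx
          rw [(hd x hx'.1).deriv]
          have h2 : -(x^2)⁻¹ + x⁻¹ + (1 - x) = - ((1 - x)^2 * (1 + x) * (x^2)⁻¹) := by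
            have := hx'.1.ne'
            field_simp
            ring
          rw [h2]
          have h0 := hx'.1
          have : 0 ≤ (1 - x)^2 * (1 + x) * (x^2)⁻¹ := by positivity
          linarith)
      have := ha (show r ∈ Set.Ioc (0:ℝ) 1 from ⟨hr, hr1⟩) (by simp) hr1
      norm_num at this
      norm_num
      linarith
  rcases le_total s 1 with h | h
  · rw [max_eq_left h, abs_of_nonneg (by linarith), div_one]
    exact (key s hs h).1
  · rw [max_eq_right h, abs_of_nonpos (by linarith)]
    have := (key (1/s) (by positivity) (by rw [div_le_one hs]; exact h)).2
    rw [one_div_one_div, one_div s, Real.log_inv] at this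
    have e : -(1 - s)/s = 1 - s⁻¹ := by field_simp; ring
    rw [e]
    linarith

/-- A nonnegative function integrable on the line takes small values far away. -/
lemma exists_small {g : ℝ → ℝ} (hg : Integrable g) {e : ℝ} (he : 0 < e) (M : ℝ) :
    (∃ b, M ≤ b ∧ g b ≤ e) ∧ (∃ a, a ≤ -M ∧ g a ≤ e) := by
  constructor
  · by_contra! h
    have h2 : IntegrableOn (fun _ : ℝ => e) (Set.Ici M) := by
      refine (hg.integrableOn (s := Set.Ici M)).mono' (by fun_prop) ?_
      refine (ae_restrict_iff' measurableSet_Ici).2 (Eventually.of_forall fun x hx => ?_)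
      rw [Real.norm_of_nonneg he.le]
      exact (h x hx).le
    rw [integrableOn_const_iff] at h2
    simp [he.ne'] at h2
  · by_contra! h
    have h2 : IntegrableOn (fun _ : ℝ => e) (Set.Iic (-M)) := by
      refine (hg.integrableOn (s := Set.Iic (-M))).mono' (by fun_prop) ?_
      refine (ae_restrict_iff' measurableSet_Iic).2 (Eventually.of_forall fun x hx => ?_)
      rw [Real.norm_of_nonneg he.le]
      exact (h x hx).le
    rw [integrableOn_const_iff] at h2
    simp [he.ne'] at h2

/-- One-dimensional stability of the Gaussian log-Sobolev inequality: for a positive `C¹`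
probability density `f` w.r.t. `γ` with finite Fisher information, and `T = F_γ⁻¹ ∘ F_μ`
the increasing transport map from `μ(dx) = f(x)φ(x)dx` to `γ`,
`(1/2)∫ (f')²/f dγ - Ent_γ(f) ≥ (1/2) (∫ |1-T'|/max(1,T') fφ dx)²`. -/
theorem logSobolev_deficit_ge_dist_dim_one (f : ℝ → ℝ) (hpos : ∀ x, 0 < f x)
    (hsmooth : ContDiff ℝ 1 f) (hnorm : ∫ x, f x ∂gaussian1 = 1)
    (hfisher : Integrable (fun x => deriv f x ^ 2 / f x) gaussian1)
    (T : ℝ → ℝ) (hT : T = transportD (fun x => f x * phi1 x) phi1) :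
    (1 / 2) * (∫ x, deriv f x ^ 2 / f x ∂gaussian1) - gEnt gaussian1 f ≥
      (1 / 2) * (∫ x, |1 - deriv T x| / max 1 (deriv T x) * (f x * phi1 x)) ^ 2 := by
  have hfc : Continuous f := hsmooth.continuous
  have hdfc : Continuous (deriv f) := hsmooth.continuous_deriv le_rfl
  have hfd : ∀ x, HasDerivAt f (deriv f x) x := fun x =>
    (hsmooth.differentiable (by norm_num) x).hasDerivAt
  have hfint : Integrable f gaussian1 := by
    by_contra h
    rw [integral_undef h] at hnorm
    norm_num at hnorm
  unfold gEnt
  rw [hnorm, Real.log_one, mul_zero, sub_zero]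
  rw [integrable_gaussian1] at hfisher hfint
  rw [integral_gaussian1] at hnorm
  rw [integral_gaussian1, integral_gaussian1]
  set u : ℝ → ℝ := fun x => f x * phi1 x with hu
  have huc : Continuous u := hfc.mul phi1_cont
  have hup : ∀ x, 0 < u x := fun x => mul_pos (hpos x) (phi1_pos x)
  have hTd : ∀ x, HasDerivAt T (u x / phi1 (T x)) x := by
    intro x; rw [hT]; exact transport_hasDerivAt huc hfint hup hnorm x
  have hTc : Continuous T := continuous_iff_continuousAt.2 fun x => (hTd x).continuousAt
  clear hT
  set S : ℝ → ℝ := fun x => u x / phi1 (T x) with hS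
  have hSp : ∀ x, 0 < S x := fun x => div_pos (hup x) (phi1_pos _)
  have hSc : Continuous S := huc.div (phi1_cont.comp hTc) fun x => (phi1_pos _).ne'
  have hdT : deriv T = S := funext fun x => (hTd x).deriv
  rw [hdT]
  have hTm : StrictMono T := strictMono_of_hasDerivAt_pos hTd hSp
  -- second moment of the image
  have hg : Integrable (fun x => (1 + T x ^ 2) * u x) := by
    refine integrable_of_intervalIntegral_norm_bounded (l := (atTop : Filter ℝ))
      (a := fun n => -n) (b := fun n => n) (∫ y, (1 + y ^ 2) * phi1 y) (fun n => ?_)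
      tendsto_neg_atTop_atBot tendsto_id ?_
    · exact (Continuous.integrableOn_Icc (by fun_prop)).mono_set Set.Ioc_subset_Icc_self
    · filter_upwards [eventually_ge_atTop (0:ℝ)] with n hn
      have e : ∀ x, ‖(1 + T x ^ 2) * u x‖ = ((fun y => (1 + y ^ 2) * phi1 y) ∘ T) x * S x := by
        intro x
        rw [Real.norm_of_nonneg (mul_nonneg (by positivity) (hup x).le)]
        simp only [Function.comp, hS]
        have := (phi1_pos (T x)).ne'
        field_simp
      simp_rw [e]
      rw [intervalIntegral.integral_comp_mul_deriv (fun x _ => hTd x) hSc.continuousOn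
        (by have := phi1_cont; fun_prop)]
      rw [intervalIntegral.integral_of_le (hTm.monotone (by linarith))]
      exact setIntegral_le_integral phi1_sq_int
        (Eventually.of_forall fun y => mul_nonneg (by positivity) (phi1_pos y).le)
  -- sequences
  have hseq : ∀ n : ℕ, ∃ p : ℝ × ℝ, (p.1 ≤ -(n:ℝ) ∧ (1 + T p.1 ^ 2) * u p.1 ≤ 1/((n:ℝ)+1)) ∧
      ((n:ℝ) ≤ p.2 ∧ (1 + T p.2 ^ 2) * u p.2 ≤ 1/((n:ℝ)+1)) := by
    intro n
    obtain ⟨⟨b, hb⟩, ⟨a, ha⟩⟩ := exists_small hg (e := 1/((n:ℝ)+1)) (by positivity) n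
    exact ⟨(a, b), ha, hb⟩
  choose p hpa hpb using hseq
  have hta : Tendsto (fun n => (p n).1) atTop atBot :=
    tendsto_atBot_mono (fun n => (hpa n).1) (tendsto_neg_atTop_atBot.comp tendsto_natCast_atTop_atTop)
  have htb : Tendsto (fun n => (p n).2) atTop atTop :=
    tendsto_atTop_mono (fun n => (hpb n).1) tendsto_natCast_atTop_atTop
  set h : ℝ → ℝ := fun x => |1 - S x| / max 1 (S x) with hh
  have hhc : Continuous h := by
    refine Continuous.div (by fun_prop) (by fun_prop) fun x => ?_
    exact (lt_of_lt_of_le one_pos (le_max_left _ _)).ne'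
  have hh0 : ∀ x, 0 ≤ h x := fun x => div_nonneg (abs_nonneg _) (le_max_of_le_left zero_le_one)
  have hh1 : ∀ x, h x ≤ 1 := by
    intro x
    refine div_le_one_of_le₀ ?_ (le_max_of_le_left zero_le_one)
    rw [abs_le]
    have := le_max_left 1 (S x)
    have := le_max_right 1 (S x)
    have := hSp x
    constructor <;> linarith
  have hhu : Integrable (fun x => h x * u x) := by
    refine hfint.mono' (by fun_prop) (Eventually.of_forall fun x => ?_)
    rw [Real.norm_of_nonneg (mul_nonneg (hh0 x) (hup x).le)]
    exact mul_le_of_le_one_left (hup x).le (hh1 x)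
  have hhu2 : Integrable (fun x => h x ^ 2 * u x) := by
    refine hfint.mono' (by fun_prop) (Eventually.of_forall fun x => ?_)
    rw [Real.norm_of_nonneg (mul_nonneg (by positivity) (hup x).le)]
    exact mul_le_of_le_one_left (hup x).le (pow_le_one₀ (hh0 x) (hh1 x))
  have hjensen : (∫ x, h x * u x) ^ 2 ≤ ∫ x, h x ^ 2 * u x := by
    set m := ∫ x, h x * u x with hm
    have h0 : 0 ≤ ∫ x, (h x - m) ^ 2 * u x :=
      integral_nonneg fun x => mul_nonneg (sq_nonneg _) (hup x).le
    have e : ∀ x, (h x - m) ^ 2 * u x = (h x ^ 2 * u x - 2 * m * (h x * u x)) + m ^ 2 * u x :=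
      fun x => by ring
    simp_rw [e] at h0
    have i1 : Integrable (fun x => h x ^ 2 * u x - 2 * m * (h x * u x)) :=
      hhu2.sub (hhu.const_mul _)
    rw [integral_add i1 (hfint.const_mul _),
      integral_sub hhu2 (hhu.const_mul _), integral_const_mul, integral_const_mul, hnorm, ← hm] at h0
    nlinarith
  -- boundary derivative
  set D : ℝ → ℝ := fun x => (deriv f x * phi1 x + f x * (-x * phi1 x)) * (T x - x) +
    u x * (S x - 1) with hD
  have hDd : ∀ x, HasDerivAt (fun x => u x * (T x - x)) (D x) x := fun x =>
    ((hfd x).mul (phi1_hasDerivAt x)).mul ((hTd x).sub (hasDerivAt_id x))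
  have hφc := phi1_cont
  have hDc : Continuous D := by fun_prop
  have hlogc : Continuous (fun x => f x * Real.log (f x) * phi1 x) :=
    (hfc.mul (hfc.log fun x => (hpos x).ne')).mul phi1_cont
  have hfic : Continuous (fun x => deriv f x ^ 2 / f x * phi1 x) :=
    ((hdfc.pow 2).div hfc fun x => (hpos x).ne').mul phi1_cont
  have hpt : ∀ x, f x * Real.log (f x) * phi1 x ≤
      (1/2) * (deriv f x ^ 2 / f x * phi1 x) - (1/2) * (h x ^ 2 * u x) + D x := by
    intro x
    have hl : Real.log (f x) = Real.log (S x) - T x ^ 2 / 2 + x ^ 2 / 2 := by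
      simp only [hS, hu]
      rw [Real.log_div (hup x).ne' (phi1_pos _).ne', Real.log_mul (hpos x).ne' (phi1_pos _).ne']
      unfold phi1
      rw [Real.log_mul (by positivity) (by positivity), Real.log_mul (by positivity) (by positivity),
        Real.log_exp, Real.log_exp]
      ring
    have he := mul_le_mul_of_nonneg_right (elem_ineq (hSp x)) (hup x).le
    have hsq : 0 ≤ (1/2) * ((T x - x) + deriv f x / f x) ^ 2 * u x :=
      mul_nonneg (by positivity) (hup x).le
    have hid : (1/2) * (deriv f x ^ 2 / f x * phi1 x) + D x - f x * Real.log (f x) * phi1 x =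
        (S x - 1 - Real.log (S x)) * u x + (1/2) * ((T x - x) + deriv f x / f x) ^ 2 * u x := by
      rw [hl]
      simp only [hD, hu]
      have := (hpos x).ne'
      field_simp
      ring
    have : 1 / 2 * (|1 - S x| / max 1 (S x)) ^ 2 * u x = 1/2 * (h x ^ 2 * u x) := by
      simp only [hh]; ring
    linarith
  have habs : ∀ t : ℝ, |t| ≤ 1 + t ^ 2 := fun t => by
    rw [abs_le]; constructor <;> nlinarith [sq_nonneg (t - 1), sq_nonneg (t + 1)]
  have hint : ∀ n : ℕ, ∫ x in (p n).1..(p n).2, f x * Real.log (f x) * phi1 x ≤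
      (1/2) * (∫ x in (p n).1..(p n).2, deriv f x ^ 2 / f x * phi1 x)
        - (1/2) * (∫ x in (p n).1..(p n).2, h x ^ 2 * u x) + 2 * (1/((n:ℝ)+1)) := by
    intro n
    obtain ⟨ha1, ha2⟩ := hpa n
    obtain ⟨hb1, hb2⟩ := hpb n
    generalize (p n).1 = a at *
    generalize (p n).2 = b at *
    have hn : (0:ℝ) ≤ n := n.cast_nonneg
    have hi := intervalIntegral.integral_mono_on (μ := volume) (a := a) (b := b) (by linarith)
      (hlogc.intervalIntegrable _ _)
      (Continuous.intervalIntegrable (by fun_prop) _ _) (fun x _ => hpt x)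
    have hc2 : Continuous (fun x => h x ^ 2 * u x) := by fun_prop
    rw [intervalIntegral.integral_add (Continuous.intervalIntegrable (by fun_prop) _ _)
        (hDc.intervalIntegrable _ _),
      intervalIntegral.integral_sub (Continuous.intervalIntegrable (by fun_prop) _ _)
        (Continuous.intervalIntegrable (by fun_prop) _ _),
      intervalIntegral.integral_const_mul, intervalIntegral.integral_const_mul,
      intervalIntegral.integral_eq_sub_of_hasDerivAt (fun x _ => hDd x)
        (hDc.intervalIntegrable _ _)] at hi
    have hB : u b * (T b - b) ≤ (1 + T b ^ 2) * u b := by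
      rw [mul_comm]
      refine mul_le_mul_of_nonneg_right ?_ (hup b).le
      have := (abs_le.1 (habs (T b))).2
      linarith
    have hA : -(u a * (T a - a)) ≤ (1 + T a ^ 2) * u a := by
      have : -(T a - a) * u a ≤ (1 + T a ^ 2) * u a := by
        refine mul_le_mul_of_nonneg_right ?_ (hup a).le
        have := (abs_le.1 (habs (T a))).1
        linarith
      linarith
    linarith
  have hlow : ∀ x, 0 ≤ f x * Real.log (f x) * phi1 x + phi1 x := by
    intro x
    have h1 := Real.one_sub_inv_le_log_of_pos (hpos x)
    have h2 := mul_le_mul_of_nonneg_left h1 (hpos x).le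
    have h3 : f x * (1 - (f x)⁻¹) = f x - 1 := by
      have := (hpos x).ne'
      field_simp
    have : 0 ≤ (f x * Real.log (f x) + 1) * phi1 x :=
      mul_nonneg (by linarith [hpos x]) (phi1_pos x).le
    linarith
  have hF := intervalIntegral_tendsto_integral hfisher hta htb
  have hH := intervalIntegral_tendsto_integral hhu2 hta htb
  have hP := intervalIntegral_tendsto_integral phi1_int hta htb
  have hE : Tendsto (fun n : ℕ => 1/((n:ℝ)+1)) atTop (𝓝 0) := tendsto_one_div_add_atTop_nhds_zero_nat
  have hR := ((hF.const_mul (1/2)).sub (hH.const_mul (1/2))).add (hE.const_mul 2)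
  have hlogint : Integrable (fun x => f x * Real.log (f x) * phi1 x) := by
    have hR' := hR.add hP
    obtain ⟨I, hI⟩ := hR'.isBoundedUnder_le
    have h1 : Integrable (fun x => f x * Real.log (f x) * phi1 x + phi1 x) := by
      refine integrable_of_intervalIntegral_norm_bounded I (fun n => ?_) hta htb ?_
      · exact (Continuous.integrableOn_Icc (by fun_prop)).mono_set Set.Ioc_subset_Icc_self
      · filter_upwards [hI] with n hn
        refine le_trans ?_ hn
        simp_rw [Real.norm_of_nonneg (hlow _)]
        rw [intervalIntegral.integral_add (hlogc.intervalIntegrable _ _)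
          (phi1_cont.intervalIntegrable _ _)]
        have := hint n
        linarith
    refine (h1.sub phi1_int).congr (Eventually.of_forall fun x => ?_)
    simp
  have hL := intervalIntegral_tendsto_integral hlogint hta htb
  have hfin := le_of_tendsto_of_tendsto' hL hR hint
  linarith

end
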